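/- Let p₁(·), p₂(·) : ℝⁿ → [1,∞) be measurable exponent functions, define p(·) by 1/p(x) = 1/p₁(x) + 1/p₂(x), and let w₁, w₂ be weights with w = w₁w₂. Then (w₁,w₂,w) ∈ A_{p⃗(·)} if and only if w₁^{−1/2} ∈ A_{2p₁'(·)}, w₂^{−1/2} ∈ A_{2p₂'(·)}, and w^{1/2} ∈ A_{2p(·)}. -/

import Mathlib

open MeasureTheory ENNReal Set

noncomputable section

/-- Euclidean space `ℝⁿ`. -/
abbrev Rn (n : ℕ) : Type := Fin n → ℝ

/-- A cube in `ℝⁿ` with sides parallel to the coordinate axes. -/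
structure Cube (n : ℕ) : Type where
  base : Fin n → ℝ
  side : ℝ
  side_pos : 0 < side

namespace Cube

/-- The set of points of a cube. -/
def toSet {n : ℕ} (Q : Cube n) : Set (Rn n) :=
  {x | ∀ i, Q.base i ≤ x i ∧ x i < Q.base i + Q.side}

/-- The volume `|Q|` of a cube. -/
def vol {n : ℕ} (Q : Cube n) : ℝ≥0∞ := ENNReal.ofReal (Q.side ^ n)

/-- Membership in the standard dyadic grid `𝒟₀`. -/
def IsDyadic {n : ℕ} (Q : Cube n) : Prop :=
  ∃ (k : ℤ) (j : Fin n → ℤ), Q.side = (2 : ℝ) ^ (-k) ∧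
    ∀ i, Q.base i = (2 : ℝ) ^ (-k) * (j i : ℝ)

end Cube

/-- The modular associated to an extended-real-valued exponent `r(·)`:
`ρ(f/λ) = ∫_{r ≠ ∞} (f/λ)^{r(x)} dμ + ‖f/λ‖_{L^∞({r = ∞})}`. -/
def eModular {n : ℕ} (r : Rn n → ℝ≥0∞) (μ : Measure (Rn n)) (f : Rn n → ℝ≥0∞)
    (lam : ℝ≥0∞) : ℝ≥0∞ :=
  (∫⁻ x in {x | r x ≠ ∞}, (f x / lam) ^ (r x).toReal ∂μ)
    + essSup (fun x => f x / lam) (μ.restrict {x | r x = ∞})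

/-- The variable Lebesgue (quasi)norm `‖f‖_{r(·)}` with respect to a measure `μ`. -/
def eNorm {n : ℕ} (r : Rn n → ℝ≥0∞) (μ : Measure (Rn n)) (f : Rn n → ℝ≥0∞) : ℝ≥0∞ :=
  sInf {lam : ℝ≥0∞ | lam ≠ 0 ∧ eModular r μ f lam ≤ 1}

/-- The variable Lebesgue norm of a real-valued function with respect to Lebesgue measure. -/
def vNorm {n : ℕ} (r : Rn n → ℝ≥0∞) (f : Rn n → ℝ) : ℝ≥0∞ :=
  eNorm r volume fun x => ENNReal.ofReal |f x|

/-- View a real-valued exponent as an extended-real-valued one. -/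
def ofExp {n : ℕ} (p : Rn n → ℝ) : Rn n → ℝ≥0∞ := fun x => ENNReal.ofReal (p x)

/-- The conjugate of an extended real exponent: `1/t + 1/t' = 1`. -/
def econj (t : ℝ≥0∞) : ℝ≥0∞ :=
  if t = 1 then ∞ else if t = ∞ then 1 else ENNReal.ofReal (t.toReal / (t.toReal - 1))

/-- The pointwise conjugate exponent `p'(·)` of a real-valued exponent. -/
def conjExp {n : ℕ} (p : Rn n → ℝ) : Rn n → ℝ≥0∞ := fun x => econj (ENNReal.ofReal (p x))

/-- A weight: a measurable function that is positive (and finite) a.e. -/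
def IsWeight {n : ℕ} (w : Rn n → ℝ) : Prop :=
  Measurable w ∧ ∀ᵐ x ∂(volume : Measure (Rn n)), 0 < w x

/-- Local log-Hölder continuity `LH₀`. -/
def LH0 {n : ℕ} (p : Rn n → ℝ) : Prop :=
  ∃ C₀ > 0, ∀ x y : Rn n, dist x y < 1 / 2 →
    |1 / p x - 1 / p y| ≤ C₀ / (-Real.log (dist x y))

/-- Log-Hölder continuity at infinity with a given asymptotic value `pinf`. -/
def LHinfWith {n : ℕ} (p : Rn n → ℝ) (pinf : ℝ) : Prop :=
  ∃ C > 0, ∀ x : Rn n, |1 / p x - 1 / pinf| ≤ C / Real.log (Real.exp 1 + ‖x‖)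

/-- Log-Hölder continuity at infinity `LH∞`. -/
def LHinf {n : ℕ} (p : Rn n → ℝ) : Prop := ∃ pinf > 0, LHinfWith p pinf

/-- Log-Hölder continuity `LH = LH₀ ∩ LH∞`. -/
def LH {n : ℕ} (p : Rn n → ℝ) : Prop := LH0 p ∧ LHinf p

/-- The bilinear variable Muckenhoupt condition `(w₁,w₂,w) ∈ A_{p⃗(·)}`. -/
def ApVec {n : ℕ} (p₁ p₂ p w₁ w₂ w : Rn n → ℝ) : Prop :=
  ∃ C : ℝ≥0∞, C ≠ ∞ ∧ ∀ Q : Cube n,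
    Q.vol⁻¹ ^ 2 * vNorm (ofExp p) (Q.toSet.indicator w) *
      vNorm (conjExp p₁) (Q.toSet.indicator fun x => (w₁ x)⁻¹) *
      vNorm (conjExp p₂) (Q.toSet.indicator fun x => (w₂ x)⁻¹) ≤ C

/-- The variable Muckenhoupt class `A_{r(·)}` for an extended-real-valued exponent. -/
def ApVarE {n : ℕ} (r : Rn n → ℝ≥0∞) (v : Rn n → ℝ) : Prop :=
  ∃ C : ℝ≥0∞, C ≠ ∞ ∧ ∀ Q : Cube n,
    Q.vol⁻¹ * vNorm r (Q.toSet.indicator v) *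
      vNorm (fun x => econj (r x)) (Q.toSet.indicator fun x => (v x)⁻¹) ≤ C

/-- The bilinear maximal operator `M(f₁,f₂)`. -/
def biMax {n : ℕ} (f₁ f₂ : Rn n → ℝ) (x : Rn n) : ℝ≥0∞ :=
  ⨆ (Q : Cube n) (_ : x ∈ Q.toSet),
    (Q.vol⁻¹ * ∫⁻ y in Q.toSet, ENNReal.ofReal |f₁ y|) *
      (Q.vol⁻¹ * ∫⁻ y in Q.toSet, ENNReal.ofReal |f₂ y|)

/-- The dyadic bilinear maximal operator `M^d(f₁,f₂)`. -/
def biMaxD {n : ℕ} (f₁ f₂ : Rn n → ℝ) (x : Rn n) : ℝ≥0∞ :=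
  ⨆ (Q : Cube n) (_ : Q.IsDyadic) (_ : x ∈ Q.toSet),
    (Q.vol⁻¹ * ∫⁻ y in Q.toSet, ENNReal.ofReal |f₁ y|) *
      (Q.vol⁻¹ * ∫⁻ y in Q.toSet, ENNReal.ofReal |f₂ y|)

/-- The bilinear averaging operator `A_Q(f₁,f₂) = (⨍_Q f₁)(⨍_Q f₂)χ_Q`. -/
def avgOp {n : ℕ} (Q : Cube n) (f₁ f₂ : Rn n → ℝ) (x : Rn n) : ℝ≥0∞ :=
  Q.toSet.indicator
    (fun _ =>
      (Q.vol⁻¹ * ∫⁻ y in Q.toSet, ENNReal.ofReal |f₁ y|) *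
        (Q.vol⁻¹ * ∫⁻ y in Q.toSet, ENNReal.ofReal |f₂ y|)) x

/-- `(p)₋(Q)`, the essential infimum of `p` on a cube `Q`. -/
def pMinusOn {n : ℕ} (p : Rn n → ℝ) (Q : Cube n) : ℝ :=
  essInf p (volume.restrict Q.toSet)

/-- The exponent `q(Q)` with `1/q(Q) = 1/(p₁)₋(Q) + 1/(p₂)₋(Q)`. -/
def qExp {n : ℕ} (p₁ p₂ : Rn n → ℝ) (Q : Cube n) : ℝ :=
  ((pMinusOn p₁ Q)⁻¹ + (pMinusOn p₂ Q)⁻¹)⁻¹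

/-- The integrand of the modular: `x ^ r` for finite `r`, and the indicator (with values `0`, `∞`)
of `x ≤ 1` for `r = ∞`. -/
def expPhi (r x : ℝ≥0∞) : ℝ≥0∞ := if r = ∞ then (if x ≤ 1 then 0 else ∞) else x ^ r.toReal

lemma expPhi_le_iff {r x m : ℝ≥0∞} (hr : r ≠ 0) (hm : m ≠ ∞) :
    expPhi r x ≤ m ↔ x ≤ m ^ (r⁻¹).toReal := by
  unfold expPhi
  by_cases h : r = ∞
  · subst h
    by_cases hx : x ≤ 1 <;> simp [hx, hm]
  · rw [if_neg h, ENNReal.toReal_inv, ENNReal.le_rpow_inv_iff (ENNReal.toReal_pos hr h)]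

lemma expPhi_mono {r x y : ℝ≥0∞} (h : x ≤ y) : expPhi r x ≤ expPhi r y := by
  unfold expPhi
  split_ifs with h1 h2 h3 h3
  · simp
  · simp
  · exact absurd (h.trans h3) h2
  · exact le_rfl
  · exact ENNReal.rpow_le_rpow h ENNReal.toReal_nonneg

lemma expPhi_zero {r : ℝ≥0∞} (hr : r ≠ 0) : expPhi r 0 = 0 := by
  have := (expPhi_le_iff (x := 0) hr ENNReal.zero_ne_top).2 (by simp)
  simpa using this

lemma expPhi_mul_le {s a b x y : ℝ≥0∞} (hs : s ≠ 0) (h : s⁻¹ = a⁻¹ + b⁻¹) :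
    expPhi s (x * y) ≤ expPhi a x + expPhi b y := by
  have hs' : s⁻¹ ≠ ∞ := by simpa using hs
  have ha' : a⁻¹ ≠ ∞ := fun hh => hs' (by rw [h, hh]; simp)
  have hb' : b⁻¹ ≠ ∞ := fun hh => hs' (by rw [h, hh]; simp)
  have ha : a ≠ 0 := by simpa using ha'
  have hb : b ≠ 0 := by simpa using hb'
  by_cases hm : expPhi a x + expPhi b y = ∞
  · rw [hm]; exact le_top
  · rw [expPhi_le_iff hs hm, h, ENNReal.toReal_add ha' hb',
      ENNReal.rpow_add_of_nonneg _ _ ENNReal.toReal_nonneg ENNReal.toReal_nonneg]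
    exact mul_le_mul' ((expPhi_le_iff ha hm).1 le_self_add) ((expPhi_le_iff hb hm).1 le_add_self)

lemma expPhi_two_mul (r x : ℝ≥0∞) : expPhi (2 * r) x = expPhi r (x ^ 2) := by
  unfold expPhi
  by_cases h : r = ∞
  · subst h
    have hx : x ^ 2 ≤ 1 ↔ x ≤ 1 := pow_le_one_iff two_ne_zero
    simp [hx]
  · rw [if_neg h, if_neg (ENNReal.mul_ne_top (by simp) h), ENNReal.toReal_mul,
      ENNReal.rpow_mul]
    simp

lemma expPhi_sq_mul_le {r k x : ℝ≥0∞} (hr : r⁻¹ ≤ 2) (hk0 : k ≠ 0) (hk : k ≤ 1) :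
    expPhi r (k ^ 2 * x) ≤ k * expPhi r x := by
  have hr0 : r ≠ 0 := by rintro rfl; simp at hr
  have hk' : k ≠ ∞ := ne_top_of_le_ne_top ENNReal.one_ne_top hk
  by_cases hm : expPhi r x = ∞
  · rw [hm, ENNReal.mul_top hk0]; exact le_top
  · rw [expPhi_le_iff hr0 (ENNReal.mul_ne_top hk' hm),
      ENNReal.mul_rpow_of_nonneg _ _ ENNReal.toReal_nonneg]
    refine mul_le_mul' ?_ ((expPhi_le_iff hr0 hm).1 le_rfl)
    rw [← ENNReal.rpow_two]
    refine ENNReal.rpow_le_rpow_of_exponent_ge hk ?_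
    simpa using ENNReal.toReal_mono (by simp) hr

lemma measurable_expPhi {α : Type*} [MeasurableSpace α] {r f : α → ℝ≥0∞}
    (hr : Measurable r) (hf : Measurable f) : Measurable fun x => expPhi (r x) (f x) := by
  unfold expPhi
  refine Measurable.ite (hr (measurableSet_singleton ∞)) ?_ (hf.pow hr.ennreal_toReal)
  exact Measurable.ite (hf measurableSet_Iic) measurable_const measurable_const

/-- The Luxemburg norm of the modular `∫ expPhi (r x) (f x)`; it is equivalent to `eNorm`. -/
def phiNorm {n : ℕ} (r f : Rn n → ℝ≥0∞) : ℝ≥0∞ :=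
  sInf {lam : ℝ≥0∞ | lam ≠ 0 ∧ ∫⁻ x, expPhi (r x) (f x / lam) ≤ 1}

section PhiNorm

variable {n : ℕ} {r f : Rn n → ℝ≥0∞}

lemma phiNorm_congr {g : Rn n → ℝ≥0∞} (h : f =ᵐ[volume] g) : phiNorm r f = phiNorm r g := by
  have key : ∀ lam, ∫⁻ x, expPhi (r x) (f x / lam) = ∫⁻ x, expPhi (r x) (g x / lam) := fun lam =>
    lintegral_congr_ae (by filter_upwards [h] with x hx; rw [hx])
  simp only [phiNorm, key]

lemma lintegral_expPhi_sq_mul_le (hr : ∀ x, (r x)⁻¹ ≤ 2) {k : ℝ≥0∞} (hk0 : k ≠ 0) (hk : k ≤ 1)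
    (g : Rn n → ℝ≥0∞) :
    ∫⁻ x, expPhi (r x) (k ^ 2 * g x) ≤ k * ∫⁻ x, expPhi (r x) (g x) := by
  rw [← lintegral_const_mul' _ _ (ne_top_of_le_ne_top ENNReal.one_ne_top hk)]
  exact lintegral_mono fun x => expPhi_sq_mul_le (hr x) hk0 hk

lemma phiNorm_le_eNorm (hrm : Measurable r) :
    phiNorm r f ≤ eNorm r volume f := by
  refine sInf_le_sInf ?_
  rintro lam ⟨h0, h1⟩
  refine ⟨h0, ?_⟩
  have hms : MeasurableSet {x | r x = ∞} := hrm (measurableSet_singleton ∞)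
  have hes : ∀ᵐ x ∂volume.restrict {x | r x = ∞}, f x / lam ≤ 1 := by
    filter_upwards [ENNReal.ae_le_essSup (μ := volume.restrict {x | r x = ∞})
      (fun x => f x / lam)] with x hx
    exact hx.trans (le_add_self.trans h1)
  rw [← lintegral_add_compl _ hms.compl, compl_compl]
  have h2 : ∫⁻ x in {x | r x = ∞}, expPhi (r x) (f x / lam) = 0 := by
    rw [lintegral_congr_ae (g := fun _ => 0)]
    · simp
    · filter_upwards [hes, ae_restrict_mem hms] with x hx hx'
      have hx'' : r x = ∞ := hx'
      simp [expPhi, hx, hx'']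
  rw [h2, add_zero]
  refine le_trans (le_of_eq ?_) (le_self_add.trans h1)
  refine setLIntegral_congr_fun hms.compl fun x hx => ?_
  have hx' : r x ≠ ∞ := hx
  simp [expPhi, hx']

lemma ennreal_four_inv : ((2 : ℝ≥0∞)⁻¹) ^ 2 = 4⁻¹ := by
  rw [← ENNReal.inv_pow]; norm_num

lemma ennreal_div_four_mul (a b : ℝ≥0∞) : a / (4 * b) = (2⁻¹) ^ 2 * (a / b) := by
  rw [ennreal_four_inv, div_eq_mul_inv, div_eq_mul_inv,
    ENNReal.mul_inv (Or.inl (by simp)) (Or.inl (by simp))]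
  ring

lemma eNorm_le_phiNorm (hr : ∀ x, (r x)⁻¹ ≤ 2) (hrm : Measurable r) (hf : Measurable f) :
    eNorm r volume f ≤ 4 * phiNorm r f := by
  rw [mul_comm, ← ENNReal.div_le_iff (by simp) (by simp)]
  refine le_sInf ?_
  rintro lam ⟨h0, h1⟩
  rw [ENNReal.div_le_iff (by simp) (by simp), mul_comm]
  refine sInf_le ⟨by simpa using h0, ?_⟩
  have hms : MeasurableSet {x | r x = ∞} := hrm (measurableSet_singleton ∞)
  have hmeas : Measurable fun x => expPhi (r x) (f x / lam) :=
    measurable_expPhi hrm (hf.div_const _)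
  have hes : ∀ᵐ x ∂volume.restrict {x | r x = ∞}, f x / (4 * lam) ≤ 2⁻¹ := by
    filter_upwards [ae_restrict_of_ae (ae_lt_top hmeas (ne_top_of_le_ne_top one_ne_top h1)),
      ae_restrict_mem hms] with x hx hx'
    have hx'' : r x = ∞ := hx'
    have hle : f x / lam ≤ 1 := by
      by_contra hcon
      simp [expPhi, hx'', hcon] at hx
    rw [ennreal_div_four_mul]
    calc (2⁻¹ : ℝ≥0∞) ^ 2 * (f x / lam) ≤ (2⁻¹) ^ 2 * 1 := by gcongr
      _ ≤ 2⁻¹ := by rw [mul_one, sq]; exact mul_le_of_le_one_left' (by simp)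
  have hint : ∫⁻ x in {x | r x ≠ ∞}, (f x / (4 * lam)) ^ (r x).toReal ≤ 2⁻¹ := by
    calc ∫⁻ x in {x | r x ≠ ∞}, (f x / (4 * lam)) ^ (r x).toReal
        = ∫⁻ x in {x | r x ≠ ∞}, expPhi (r x) ((2⁻¹) ^ 2 * (f x / lam)) := by
          refine setLIntegral_congr_fun hms.compl fun x hx => ?_
          have hx' : r x ≠ ∞ := hx
          simp only [expPhi, if_neg hx', ennreal_div_four_mul]
      _ ≤ ∫⁻ x, expPhi (r x) ((2⁻¹) ^ 2 * (f x / lam)) := setLIntegral_le_lintegral _ _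
      _ ≤ 2⁻¹ * ∫⁻ x, expPhi (r x) (f x / lam) :=
          lintegral_expPhi_sq_mul_le hr (by simp) (by simp) _
      _ ≤ 2⁻¹ * 1 := by gcongr
      _ = 2⁻¹ := mul_one _
  calc eModular r volume f (4 * lam) ≤ 2⁻¹ + 2⁻¹ := add_le_add hint (essSup_le_of_ae_le _ hes)
    _ = 1 := ENNReal.inv_two_add_inv_two

lemma phiNorm_eq_zero (hr : ∀ x, (r x)⁻¹ ≤ 2) (hrm : Measurable r) (hf : Measurable f)
    (h : phiNorm r f = 0) : f =ᵐ[volume] 0 := by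
  have key : ∀ lam : ℝ≥0∞, lam ≠ 0 → ∀ᵐ x ∂volume, f x ≤ lam := by
    intro lam hlam
    by_cases hlt : lam = ∞
    · simp [hlt]
    have hmeas : Measurable fun x => expPhi (r x) (f x / lam) :=
      measurable_expPhi hrm (hf.div_const _)
    have hz : ∫⁻ x, expPhi (r x) (f x / lam) = 0 := by
      by_contra hne
      obtain ⟨k, hk0, hk⟩ := exists_between (lt_min zero_lt_one (pos_iff_ne_zero.2 hne))
      have hk1 : k ≤ 1 := (hk.trans_le (min_le_left _ _)).le
      have hpos : phiNorm r f < k ^ 2 * lam := by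
        rw [h]; exact ENNReal.mul_pos (pow_ne_zero _ hk0.ne') hlam
      obtain ⟨mu, ⟨hmu0, hmu⟩, hmulam⟩ := sInf_lt_iff.1 hpos
      refine absurd (hk.trans_le (min_le_right _ _)) (not_lt.2 ?_)
      calc ∫⁻ x, expPhi (r x) (f x / lam)
          ≤ ∫⁻ x, expPhi (r x) (k ^ 2 * (f x / mu)) := by
            refine lintegral_mono fun x => expPhi_mono ?_
            rw [ENNReal.div_le_iff hlam hlt]
            calc f x ≤ mu * (f x / mu) := by
                  rw [ENNReal.mul_div_cancel hmu0 (hmulam.trans_le le_top).ne]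
              _ ≤ (k ^ 2 * lam) * (f x / mu) := by gcongr
              _ = k ^ 2 * (f x / mu) * lam := by ring
        _ ≤ k * ∫⁻ x, expPhi (r x) (f x / mu) := lintegral_expPhi_sq_mul_le hr hk0.ne' hk1 _
        _ ≤ k * 1 := by gcongr
        _ = k := mul_one _
    filter_upwards [(lintegral_eq_zero_iff hmeas).1 hz] with x hx
    have hr0 : r x ≠ 0 := fun h0 => by simpa [h0] using hr x
    have h1 := (expPhi_le_iff hr0 ENNReal.zero_ne_top).1 (le_of_eq hx)
    have h2 : f x / lam ≤ 1 := by
      refine h1.trans ?_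
      exact ENNReal.rpow_le_one zero_le_one ENNReal.toReal_nonneg
    simpa using (ENNReal.div_le_iff hlam hlt).1 h2
  have hall : ∀ᵐ x ∂volume, ∀ m : ℕ, f x ≤ ((m : ℝ≥0∞))⁻¹ :=
    ae_all_iff.2 fun m => key _ (by simp)
  filter_upwards [hall] with x hx
  by_contra hne
  obtain ⟨m, hm⟩ := ENNReal.exists_inv_nat_lt hne
  exact absurd (hx m) (not_le.2 hm)

lemma phiNorm_zero (hr : ∀ x, (r x)⁻¹ ≤ 2) : phiNorm r 0 = 0 := by
  refine le_antisymm (le_of_forall_gt fun c hc => ?_) zero_le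
  obtain ⟨d, hd0, hd⟩ := exists_between hc
  refine lt_of_le_of_lt (sInf_le ⟨hd0.ne', ?_⟩) hd
  have : ∀ x, expPhi (r x) ((0 : Rn n → ℝ≥0∞) x / d) = 0 := fun x => by
    have hr0 : r x ≠ 0 := fun h0 => by simpa [h0] using hr x
    simpa using expPhi_zero hr0
  rw [lintegral_congr this]
  simp

/-- Hölder's inequality for `phiNorm`. -/
lemma phiNorm_mul_le {s a b f g F : Rn n → ℝ≥0∞} (hs : ∀ x, (s x)⁻¹ ≤ 2)
    (h : ∀ x, (s x)⁻¹ = (a x)⁻¹ + (b x)⁻¹) (ham : Measurable a) (hbm : Measurable b)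
    (hf : Measurable f) (hg : Measurable g) (hF : F =ᵐ[volume] f * g) :
    phiNorm s F ≤ 4 * (phiNorm a f * phiNorm b g) := by
  rw [phiNorm_congr hF]
  have ha : ∀ x, (a x)⁻¹ ≤ 2 := fun x => (le_self_add.trans (h x).ge).trans (hs x)
  have hb : ∀ x, (b x)⁻¹ ≤ 2 := fun x => (le_add_self.trans (h x).ge).trans (hs x)
  by_cases hfz : phiNorm a f = 0
  · have : f * g =ᵐ[volume] 0 := by
      filter_upwards [phiNorm_eq_zero ha ham hf hfz] with x hx
      simp [hx]
    rw [phiNorm_congr this, phiNorm_zero hs]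
    exact zero_le
  by_cases hgz : phiNorm b g = 0
  · have : f * g =ᵐ[volume] 0 := by
      filter_upwards [phiNorm_eq_zero hb hbm hg hgz] with x hx
      simp [hx]
    rw [phiNorm_congr this, phiNorm_zero hs]
    exact zero_le
  rw [mul_comm 4, ← ENNReal.div_le_iff (by simp) (by simp)]
  refine ENNReal.le_mul_of_forall_lt (Or.inl hfz) (Or.inr hgz) fun a' ha' b' hb' => ?_
  obtain ⟨lam, ⟨hlam0, hlam⟩, hlt⟩ := sInf_lt_iff.1 ha'
  obtain ⟨mu, ⟨hmu0, hmu⟩, hmt⟩ := sInf_lt_iff.1 hb'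
  refine le_trans ?_ (mul_le_mul' hlt.le hmt.le)
  rw [ENNReal.div_le_iff (by simp) (by simp), mul_comm _ 4]
  refine sInf_le ⟨by simp [hlam0, hmu0], ?_⟩
  calc ∫⁻ x, expPhi (s x) ((f * g) x / (4 * (lam * mu)))
      = ∫⁻ x, expPhi (s x) ((2⁻¹) ^ 2 * ((f x / lam) * (g x / mu))) := by
        refine lintegral_congr fun x => ?_
        rw [ennreal_div_four_mul, Pi.mul_apply, div_eq_mul_inv, div_eq_mul_inv, div_eq_mul_inv,
          ENNReal.mul_inv (Or.inl hlam0) (Or.inr hmu0), mul_mul_mul_comm]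
    _ ≤ 2⁻¹ * ∫⁻ x, expPhi (s x) ((f x / lam) * (g x / mu)) :=
        lintegral_expPhi_sq_mul_le hs (by simp) (by simp) _
    _ ≤ 2⁻¹ * ∫⁻ x, (expPhi (a x) (f x / lam) + expPhi (b x) (g x / mu)) := by
        gcongr with x
        exact expPhi_mul_le (fun h0 => by simpa [h0] using hs x) (h x)
    _ ≤ 2⁻¹ * (1 + 1) := by
        rw [lintegral_add_left (measurable_expPhi ham (hf.div_const _))]
        gcongr
    _ = 1 := by rw [one_add_one_eq_two]; exact ENNReal.inv_mul_cancel (by simp) (by simp)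

lemma phiNorm_sq {F : Rn n → ℝ≥0∞} (hF : F =ᵐ[volume] f ^ 2) :
    phiNorm r F = phiNorm (fun x => 2 * r x) f ^ 2 := by
  rw [phiNorm_congr hF]
  have key : ∀ lam : ℝ≥0∞, lam ≠ 0 → ∫⁻ x, expPhi (2 * r x) (f x / lam) =
      ∫⁻ x, expPhi (r x) ((f ^ 2) x / lam ^ 2) := by
    intro lam hlam
    refine lintegral_congr fun x => ?_
    rw [expPhi_two_mul, Pi.pow_apply, div_eq_mul_inv, div_eq_mul_inv, mul_pow, ENNReal.inv_pow]
  refine le_antisymm ?_ ?_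
  · have h1 : phiNorm r (f ^ 2) ^ (2⁻¹ : ℝ) ≤ phiNorm (fun x => 2 * r x) f := by
      refine le_sInf ?_
      rintro lam ⟨h0, h1⟩
      rw [ENNReal.rpow_inv_le_iff (by norm_num), ENNReal.rpow_two]
      exact sInf_le ⟨pow_ne_zero _ h0, by rwa [← key lam h0]⟩
    rwa [ENNReal.rpow_inv_le_iff (by norm_num), ENNReal.rpow_two] at h1
  · refine le_sInf ?_
    rintro lam ⟨h0, h1⟩
    rw [← ENNReal.rpow_two, ← ENNReal.le_rpow_inv_iff (by norm_num)]
    have hl0 : lam ^ (2⁻¹ : ℝ) ≠ 0 := by simp [h0]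
    refine sInf_le ⟨hl0, ?_⟩
    rw [key _ hl0, ← ENNReal.rpow_two, ENNReal.rpow_inv_rpow (by norm_num)]
    exact h1

end PhiNorm

lemma phiNorm_half_indicator {n : ℕ} {s : Set (Rn n)} (hs : MeasurableSet s) :
    volume s ^ 2 ≤ phiNorm (fun _ => 2⁻¹) (s.indicator 1) := by
  refine le_sInf ?_
  rintro lam ⟨h0, h1⟩
  by_cases hlam : lam = ∞
  · rw [hlam]; exact le_top
  have hpt : ∀ x, expPhi 2⁻¹ (s.indicator 1 x / lam) =
      s.indicator (fun _ => (lam ^ (2⁻¹ : ℝ))⁻¹) x := by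
    intro x
    have h2 : (2⁻¹ : ℝ≥0∞) ≠ ∞ := by simp
    by_cases hx : x ∈ s
    · simp [expPhi, hx, ENNReal.inv_rpow]
    · simp [expPhi, hx]
  rw [lintegral_congr hpt, lintegral_indicator_const hs, mul_comm, ← div_eq_mul_inv,
    ENNReal.div_le_iff (by simp [h0]) (by simp [hlam]), one_mul,
    ENNReal.le_rpow_inv_iff (by norm_num), ENNReal.rpow_two] at h1
  exact h1

namespace Cube

variable {n : ℕ}

lemma toSet_eq_pi (Q : Cube n) :
    Q.toSet = Set.pi univ fun i => Ico (Q.base i) (Q.base i + Q.side) := by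
  ext x; simp [toSet]

lemma measurableSet_toSet (Q : Cube n) : MeasurableSet Q.toSet := by
  rw [toSet_eq_pi]
  exact MeasurableSet.univ_pi fun i => measurableSet_Ico

lemma volume_toSet (Q : Cube n) : volume Q.toSet = Q.vol := by
  rw [toSet_eq_pi, Real.volume_pi_Ico]
  simp [vol, ENNReal.ofReal_pow Q.side_pos.le]

lemma vol_ne_zero (Q : Cube n) : Q.vol ≠ 0 := by
  simp [vol, pow_pos Q.side_pos]

lemma vol_ne_top (Q : Cube n) : Q.vol ≠ ∞ := ENNReal.ofReal_ne_top

/-- The function `|u|χ_Q` with values in `ℝ≥0∞`. -/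
def cut (Q : Cube n) (u : Rn n → ℝ) : Rn n → ℝ≥0∞ :=
  fun x => ENNReal.ofReal |Q.toSet.indicator u x|

variable (Q : Cube n) {u v : Rn n → ℝ}

lemma measurable_cut (hu : Measurable u) : Measurable (Q.cut u) :=
  (hu.indicator Q.measurableSet_toSet).abs.ennreal_ofReal

lemma cut_ae_eq_mul {z : Rn n → ℝ} (h : ∀ᵐ x ∂volume, z x = u x * v x) :
    Q.cut z =ᵐ[volume] Q.cut u * Q.cut v := by
  filter_upwards [h] with x hx
  by_cases hxQ : x ∈ Q.toSet
  · simp [cut, hxQ, hx, abs_mul, ENNReal.ofReal_mul]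
  · simp [cut, hxQ]

lemma cut_ae_eq_sq {z : Rn n → ℝ} (h : ∀ᵐ x ∂volume, z x = u x ^ 2) :
    Q.cut z =ᵐ[volume] Q.cut u ^ 2 := by
  rw [sq]
  exact Q.cut_ae_eq_mul (by simpa only [sq] using h)

end Cube

section Norms

variable {n : ℕ}

lemma phiNorm_le_vNorm {r : Rn n → ℝ≥0∞} (hrm : Measurable r) (Q : Cube n) (u : Rn n → ℝ) :
    phiNorm r (Q.cut u) ≤ vNorm r (Q.toSet.indicator u) :=
  phiNorm_le_eNorm hrm

lemma vNorm_le_phiNorm {r : Rn n → ℝ≥0∞} (hr : ∀ x, (r x)⁻¹ ≤ 2) (hrm : Measurable r) (Q : Cube n)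
    {u : Rn n → ℝ} (hu : Measurable u) :
    vNorm r (Q.toSet.indicator u) ≤ 4 * phiNorm r (Q.cut u) :=
  eNorm_le_phiNorm hr hrm (Q.measurable_cut hu)

lemma econj_inv_add {t : ℝ≥0∞} (ht : 1 ≤ t) : t⁻¹ + (econj t)⁻¹ = 1 := by
  unfold econj
  by_cases h1 : t = 1
  · simp [h1]
  by_cases h2 : t = ∞
  · simp [h2]
  rw [if_neg h1, if_neg h2]
  lift t to NNReal using h2
  have hlt : (1 : ℝ) < t := by
    have : (1 : ℝ≥0∞) < t := lt_of_le_of_ne ht (Ne.symm h1)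
    exact_mod_cast this
  have h0 : (0 : ℝ) < t := by linarith
  have h0' : (0 : ℝ) < t - 1 := by linarith
  rw [← ENNReal.ofReal_inv_of_pos (by simp only [ENNReal.coe_toReal]; positivity),
    ← ENNReal.ofReal_coe_nnreal, ← ENNReal.ofReal_inv_of_pos h0,
    ← ENNReal.ofReal_add (by positivity) (by rw [ENNReal.toReal_ofReal h0.le]; positivity),
    ENNReal.toReal_ofReal h0.le, ENNReal.ofReal_eq_one]
  field_simp
  ring

lemma measurable_econj : Measurable econj := by
  unfold econj
  refine Measurable.ite (measurableSet_singleton 1) measurable_const ?_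
  refine Measurable.ite (measurableSet_singleton ∞) measurable_const ?_
  exact (ENNReal.measurable_toReal.div (ENNReal.measurable_toReal.sub_const 1)).ennreal_ofReal

lemma econj_inv_le {t : ℝ≥0∞} (ht : 1 ≤ t) : (econj t)⁻¹ ≤ 1 :=
  le_add_self.trans (econj_inv_add ht).le

lemma one_le_econj {t : ℝ≥0∞} (ht : 1 ≤ t) : 1 ≤ econj t := by
  simpa using econj_inv_le ht

lemma ApVarE_iff {r : Rn n → ℝ≥0∞} {v : Rn n → ℝ} (hr : ∀ x, 1 ≤ r x) (hrm : Measurable r)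
    (hv : Measurable v) :
    ApVarE r v ↔ ∃ C : ℝ≥0∞, C ≠ ∞ ∧ ∀ Q : Cube n,
      phiNorm r (Q.cut v) * phiNorm (fun x => econj (r x)) (Q.cut fun x => (v x)⁻¹) ≤
        C * Q.vol := by
  have hle : ∀ x, (r x)⁻¹ ≤ 2 := fun x => (ENNReal.inv_le_one.2 (hr x)).trans one_le_two
  have hle' : ∀ x, (econj (r x))⁻¹ ≤ 2 := fun x => (econj_inv_le (hr x)).trans one_le_two
  have hem : Measurable fun x => econj (r x) := measurable_econj.comp hrm
  have hstep : ∀ (Q : Cube n) (N C : ℝ≥0∞), Q.vol⁻¹ * N ≤ C ↔ N ≤ C * Q.vol := fun Q N C => by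
    rw [mul_comm, ← div_eq_mul_inv, ENNReal.div_le_iff Q.vol_ne_zero Q.vol_ne_top]
  constructor
  · rintro ⟨C, hC, h⟩
    refine ⟨C, hC, fun Q => ?_⟩
    refine le_trans ?_ ((hstep Q _ C).1 (by simpa only [mul_assoc] using h Q))
    exact mul_le_mul' (phiNorm_le_vNorm hrm Q _) (phiNorm_le_vNorm hem Q _)
  · rintro ⟨C, hC, h⟩
    refine ⟨16 * C, ENNReal.mul_ne_top (by simp) hC, fun Q => ?_⟩
    rw [mul_assoc, hstep]
    calc _ ≤ (4 * phiNorm r (Q.cut v)) *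
          (4 * phiNorm (fun x => econj (r x)) (Q.cut fun x => (v x)⁻¹)) :=
          mul_le_mul' (vNorm_le_phiNorm hle hrm Q hv) (vNorm_le_phiNorm hle' hem Q hv.inv)
      _ = 16 * (phiNorm r (Q.cut v) *
          phiNorm (fun x => econj (r x)) (Q.cut fun x => (v x)⁻¹)) := by ring
      _ ≤ 16 * (C * Q.vol) := mul_le_mul_right (h Q) _
      _ = 16 * C * Q.vol := by ring

lemma ApVec_iff {p₁ p₂ p w₁ w₂ w : Rn n → ℝ}
    (hc₁ : ∀ x, (conjExp p₁ x)⁻¹ ≤ 2) (hc₂ : ∀ x, (conjExp p₂ x)⁻¹ ≤ 2)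
    (hp : ∀ x, (ofExp p x)⁻¹ ≤ 2) (hm₁ : Measurable (conjExp p₁)) (hm₂ : Measurable (conjExp p₂))
    (hm : Measurable (ofExp p)) (hw₁ : Measurable w₁) (hw₂ : Measurable w₂) (hw : Measurable w) :
    ApVec p₁ p₂ p w₁ w₂ w ↔ ∃ C : ℝ≥0∞, C ≠ ∞ ∧ ∀ Q : Cube n,
      phiNorm (ofExp p) (Q.cut w) * phiNorm (conjExp p₁) (Q.cut fun x => (w₁ x)⁻¹) *
        phiNorm (conjExp p₂) (Q.cut fun x => (w₂ x)⁻¹) ≤ C * Q.vol ^ 2 := by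
  have hstep : ∀ (Q : Cube n) (N C : ℝ≥0∞), Q.vol⁻¹ ^ 2 * N ≤ C ↔ N ≤ C * Q.vol ^ 2 :=
    fun Q N C => by
      rw [mul_comm, ← ENNReal.inv_pow, ← div_eq_mul_inv,
        ENNReal.div_le_iff (pow_ne_zero _ Q.vol_ne_zero) (ENNReal.pow_ne_top Q.vol_ne_top)]
  constructor
  · rintro ⟨C, hC, h⟩
    refine ⟨C, hC, fun Q => ?_⟩
    refine le_trans ?_ ((hstep Q _ C).1 (by simpa only [mul_assoc] using h Q))
    rw [mul_assoc]
    exact mul_le_mul' (phiNorm_le_vNorm hm Q _)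
      (mul_le_mul' (phiNorm_le_vNorm hm₁ Q _) (phiNorm_le_vNorm hm₂ Q _))
  · rintro ⟨C, hC, h⟩
    refine ⟨64 * C, ENNReal.mul_ne_top (by simp) hC, fun Q => ?_⟩
    rw [mul_assoc, mul_assoc, hstep]
    calc _ ≤ (4 * phiNorm (ofExp p) (Q.cut w)) *
          ((4 * phiNorm (conjExp p₁) (Q.cut fun x => (w₁ x)⁻¹)) *
            (4 * phiNorm (conjExp p₂) (Q.cut fun x => (w₂ x)⁻¹))) :=
          mul_le_mul' (vNorm_le_phiNorm hp hm Q hw)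
            (mul_le_mul' (vNorm_le_phiNorm hc₁ hm₁ Q hw₁.inv)
              (vNorm_le_phiNorm hc₂ hm₂ Q hw₂.inv))
      _ = 64 * (phiNorm (ofExp p) (Q.cut w) * phiNorm (conjExp p₁) (Q.cut fun x => (w₁ x)⁻¹) *
            phiNorm (conjExp p₂) (Q.cut fun x => (w₂ x)⁻¹)) := by ring
      _ ≤ 64 * (C * Q.vol ^ 2) := mul_le_mul_right (h Q) _
      _ = 64 * C * Q.vol ^ 2 := by ring

/-- Linear relations between reciprocal exponents: `cᵢ` is conjugate to `aᵢ`, `sᵢ` to `cᵢ / 2`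
and `s` to `(a₁ + a₂) / 2`. -/
lemma reciprocal_relations {a₁ a₂ c₁ c₂ s₁ s₂ s : ℝ≥0∞} (h₁ : a₁ + c₁ = 1) (h₂ : a₂ + c₂ = 1)
    (hs₁ : 2⁻¹ * c₁ + s₁ = 1) (hs₂ : 2⁻¹ * c₂ + s₂ = 1) (hs : 2⁻¹ * (a₁ + a₂) + s = 1) :
    s₁ = 2⁻¹ * (a₁ + a₂) + 2⁻¹ * c₂ ∧ s₂ = 2⁻¹ * (a₁ + a₂) + 2⁻¹ * c₁ ∧
      s = 2⁻¹ * c₁ + 2⁻¹ * c₂ ∧ 2 = s + (s₁ + s₂) := by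
  have fin : ∀ {x y : ℝ≥0∞}, x + y = 1 → x ≠ ∞ ∧ y ≠ ∞ := fun h =>
    ENNReal.add_ne_top.1 (h ▸ ENNReal.one_ne_top)
  have two : (2⁻¹ : ℝ≥0∞) = ((2⁻¹ : NNReal) : ℝ≥0∞) := by simp
  lift a₁ to NNReal using (fin h₁).1
  lift c₁ to NNReal using (fin h₁).2
  lift a₂ to NNReal using (fin h₂).1
  lift c₂ to NNReal using (fin h₂).2
  lift s₁ to NNReal using (fin hs₁).2
  lift s₂ to NNReal using (fin hs₂).2
  lift s to NNReal using (fin hs).2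
  rw [two] at *
  norm_cast at *
  rw [← NNReal.coe_inj] at *
  push_cast at *
  refine ⟨?_, ?_, ?_, ?_⟩ <;> (try rw [← NNReal.coe_inj]) <;> push_cast <;> linarith

end Norms

/-- `(w₁,w₂,w) ∈ A_{p⃗(·)}` iff `w₁^{-1/2} ∈ A_{2p₁'(·)}`,
`w₂^{-1/2} ∈ A_{2p₂'(·)}` and `w^{1/2} ∈ A_{2p(·)}`. -/
theorem statement4 {n : ℕ} (p₁ p₂ p w₁ w₂ w : Rn n → ℝ)
    (hp₁m : Measurable p₁) (hp₂m : Measurable p₂)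
    (hp₁1 : ∀ x, 1 ≤ p₁ x) (hp₂1 : ∀ x, 1 ≤ p₂ x)
    (hp : ∀ x, 1 / p x = 1 / p₁ x + 1 / p₂ x)
    (hw₁ : IsWeight w₁) (hw₂ : IsWeight w₂)
    (hw : ∀ x, w x = w₁ x * w₂ x) :
    ApVec p₁ p₂ p w₁ w₂ w ↔
      (ApVarE (fun x => 2 * conjExp p₁ x) (fun x => w₁ x ^ (-(1 / 2) : ℝ)) ∧
        ApVarE (fun x => 2 * conjExp p₂ x) (fun x => w₂ x ^ (-(1 / 2) : ℝ)) ∧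
        ApVarE (fun x => ENNReal.ofReal (2 * p x)) (fun x => w x ^ ((1 / 2) : ℝ))) := by
  have hc₁ : ∀ x, 1 ≤ ENNReal.ofReal (p₁ x) := fun x => ENNReal.one_le_ofReal.2 (hp₁1 x)
  have hc₂ : ∀ x, 1 ≤ ENNReal.ofReal (p₂ x) := fun x => ENNReal.one_le_ofReal.2 (hp₂1 x)
  have hpos₁ : ∀ x, 0 < p₁ x := fun x => one_pos.trans_le (hp₁1 x)
  have hpos₂ : ∀ x, 0 < p₂ x := fun x => one_pos.trans_le (hp₂1 x)
  have hpos : ∀ x, 0 < p x := fun x => by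
    have h1 := one_div_pos.2 (hpos₁ x)
    have h2 := one_div_pos.2 (hpos₂ x)
    exact one_div_pos.1 (by rw [hp x]; positivity)
  have hpm : Measurable p := by
    have : p = fun x => (1 / p₁ x + 1 / p₂ x)⁻¹ := by
      funext x
      rw [← hp x, one_div, inv_inv]
    rw [this]
    exact ((hp₁m.const_div 1).add (hp₂m.const_div 1)).inv
  have hwm : Measurable w := by
    rw [funext hw]
    exact hw₁.1.mul hw₂.1
  have hinv : ∀ x, (ofExp p x)⁻¹ = (ENNReal.ofReal (p₁ x))⁻¹ + (ENNReal.ofReal (p₂ x))⁻¹ := by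
    intro x
    have h1 := one_div_pos.2 (hpos₁ x)
    have h2 := one_div_pos.2 (hpos₂ x)
    rw [ofExp, ← ENNReal.ofReal_inv_of_pos (hpos x), ← ENNReal.ofReal_inv_of_pos (hpos₁ x),
      ← ENNReal.ofReal_inv_of_pos (hpos₂ x), ← ENNReal.ofReal_add (by simpa using h1.le)
      (by simpa using h2.le)]
    simpa only [one_div] using congrArg ENNReal.ofReal (hp x)
  have hr : (fun x => ENNReal.ofReal (2 * p x)) = fun x => 2 * ofExp p x := by
    funext x
    simp [ofExp, ENNReal.ofReal_mul]
  rw [hr]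
  have two_mul_inv : ∀ t : ℝ≥0∞, (2 * t)⁻¹ = 2⁻¹ * t⁻¹ := fun t =>
    ENNReal.mul_inv (Or.inl (by simp)) (Or.inl (by simp))
  have hP : ∀ x, (ofExp p x)⁻¹ ≤ 2 := fun x => by
    rw [hinv, ← one_add_one_eq_two]
    exact add_le_add (ENNReal.inv_le_one.2 (hc₁ x)) (ENNReal.inv_le_one.2 (hc₂ x))
  have hC₁ : ∀ x, 1 ≤ conjExp p₁ x := fun x => one_le_econj (hc₁ x)
  have hC₂ : ∀ x, 1 ≤ conjExp p₂ x := fun x => one_le_econj (hc₂ x)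
  have hR : ∀ x, 1 ≤ 2 * ofExp p x := fun x => by
    rw [← ENNReal.inv_le_one, two_mul_inv]
    calc 2⁻¹ * (ofExp p x)⁻¹ ≤ 2⁻¹ * 2 := by gcongr; exact hP x
      _ = 1 := ENNReal.inv_mul_cancel (by simp) (by simp)
  have hR₁ : ∀ x, 1 ≤ 2 * conjExp p₁ x := fun x => one_le_mul one_le_two (hC₁ x)
  have hR₂ : ∀ x, 1 ≤ 2 * conjExp p₂ x := fun x => one_le_mul one_le_two (hC₂ x)
  have hPm : Measurable (ofExp p) := hpm.ennreal_ofReal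
  have hCm₁ : Measurable (conjExp p₁) := measurable_econj.comp hp₁m.ennreal_ofReal
  have hCm₂ : Measurable (conjExp p₂) := measurable_econj.comp hp₂m.ennreal_ofReal
  have hv₁ : Measurable fun x => w₁ x ^ (-(1 / 2) : ℝ) := hw₁.1.pow_const _
  have hv₂ : Measurable fun x => w₂ x ^ (-(1 / 2) : ℝ) := hw₂.1.pow_const _
  have hv : Measurable fun x => w x ^ ((1 / 2) : ℝ) := hwm.pow_const _
  have hSm₁ : Measurable fun x => econj (2 * conjExp p₁ x) :=
    measurable_econj.comp (hCm₁.const_mul 2)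
  have hSm₂ : Measurable fun x => econj (2 * conjExp p₂ x) :=
    measurable_econj.comp (hCm₂.const_mul 2)
  have hSm : Measurable fun x => econj (2 * ofExp p x) :=
    measurable_econj.comp (hPm.const_mul 2)
  have hle : ∀ {t : ℝ≥0∞}, 1 ≤ t → t⁻¹ ≤ 2 := fun h => (ENNReal.inv_le_one.2 h).trans one_le_two
  have hrec := fun x => reciprocal_relations (econj_inv_add (hc₁ x)) (econj_inv_add (hc₂ x))
    (c₁ := (conjExp p₁ x)⁻¹) (c₂ := (conjExp p₂ x)⁻¹)
    (s₁ := (econj (2 * conjExp p₁ x))⁻¹) (s₂ := (econj (2 * conjExp p₂ x))⁻¹)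
    (s := (econj (2 * ofExp p x))⁻¹)
    (by rw [← econj_inv_add (hR₁ x), two_mul_inv])
    (by rw [← econj_inv_add (hR₂ x), two_mul_inv])
    (by rw [← econj_inv_add (hR x), two_mul_inv, hinv])
  simp only [← hinv, ← two_mul_inv] at hrec
  rw [ApVec_iff (fun x => hle (hC₁ x)) (fun x => hle (hC₂ x)) hP hCm₁ hCm₂ hPm hw₁.1 hw₂.1 hwm,
    ApVarE_iff hR₁ (hCm₁.const_mul 2) hv₁, ApVarE_iff hR₂ (hCm₂.const_mul 2) hv₂,
    ApVarE_iff hR (hPm.const_mul 2) hv]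
  have hroot : ∀ᵐ x ∂(volume : Measure (Rn n)), ∃ a b : ℝ, 0 < a ∧ 0 < b ∧ w₁ x = a ^ 2 ∧
      w₂ x = b ^ 2 ∧ w₁ x ^ (-(1 / 2) : ℝ) = a⁻¹ ∧ w₂ x ^ (-(1 / 2) : ℝ) = b⁻¹ ∧
      w x ^ ((1 / 2) : ℝ) = a * b := by
    filter_upwards [hw₁.2, hw₂.2] with x h1 h2
    refine ⟨√(w₁ x), √(w₂ x), Real.sqrt_pos.2 h1, Real.sqrt_pos.2 h2, (Real.sq_sqrt h1.le).symm,
      (Real.sq_sqrt h2.le).symm, ?_, ?_, ?_⟩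
    · rw [Real.rpow_neg h1.le, Real.sqrt_eq_rpow]
    · rw [Real.rpow_neg h2.le, Real.sqrt_eq_rpow]
    · rw [hw, ← Real.sqrt_eq_rpow, Real.sqrt_mul h1.le]
  have hsq : ∀ Q : Cube n, phiNorm (ofExp p) (Q.cut w) =
      phiNorm (fun x => 2 * ofExp p x) (Q.cut fun x => w x ^ ((1 / 2) : ℝ)) ^ 2 := fun Q => by
    refine phiNorm_sq (Q.cut_ae_eq_sq ?_)
    filter_upwards [hroot] with x ⟨a, b, ha, hb, e1, e2, e3, e4, e5⟩
    rw [e5, hw, e1, e2, mul_pow]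
  have hsq₁ : ∀ Q : Cube n, phiNorm (conjExp p₁) (Q.cut fun x => (w₁ x)⁻¹) =
      phiNorm (fun x => 2 * conjExp p₁ x) (Q.cut fun x => w₁ x ^ (-(1 / 2) : ℝ)) ^ 2 := fun Q => by
    refine phiNorm_sq (Q.cut_ae_eq_sq ?_)
    filter_upwards [hroot] with x ⟨a, b, ha, hb, e1, e2, e3, e4, e5⟩
    rw [e3, e1, inv_pow]
  have hsq₂ : ∀ Q : Cube n, phiNorm (conjExp p₂) (Q.cut fun x => (w₂ x)⁻¹) =
      phiNorm (fun x => 2 * conjExp p₂ x) (Q.cut fun x => w₂ x ^ (-(1 / 2) : ℝ)) ^ 2 := fun Q => by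
    refine phiNorm_sq (Q.cut_ae_eq_sq ?_)
    filter_upwards [hroot] with x ⟨a, b, ha, hb, e1, e2, e3, e4, e5⟩
    rw [e4, e2, inv_pow]
  simp only [hsq, hsq₁, hsq₂, ← mul_pow]
  have le_of_sq_le_sq : ∀ {a b : ℝ≥0∞}, a ^ 2 ≤ b ^ 2 → a ≤ b := fun hab =>
    le_of_not_gt fun hlt => absurd hab (not_le.2 (ENNReal.pow_lt_pow_left two_ne_zero hlt))
  constructor
  · rintro ⟨C, hC, h⟩
    have hroot_le := fun Q : Cube n => by
      refine le_of_sq_le_sq ((h Q).trans (?_ : _ ≤ ((1 + C) * Q.vol) ^ 2))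
      rw [mul_pow]
      refine mul_le_mul_left ?_ _
      calc C ≤ 1 + C := le_add_self
        _ ≤ (1 + C) ^ 2 := le_self_pow₀ le_self_add two_ne_zero
    have hC' : 4 * (1 + C) ≠ ∞ := ENNReal.mul_ne_top (by simp) (by simp [hC])
    refine ⟨⟨4 * (1 + C), hC', fun Q => ?_⟩, ⟨4 * (1 + C), hC', fun Q => ?_⟩,
      ⟨4 * (1 + C), hC', fun Q => ?_⟩⟩
    · have key := phiNorm_mul_le (fun x => (econj_inv_le (hR₁ x)).trans one_le_two)
        (fun x => (hrec x).1) (hPm.const_mul 2) (hCm₂.const_mul 2)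
        (Q.measurable_cut hv) (Q.measurable_cut hv₂)
        (Q.cut_ae_eq_mul (z := fun x => (w₁ x ^ (-(1 / 2) : ℝ))⁻¹) (by
          filter_upwards [hroot] with x ⟨a, b, ha, hb, e1, e2, e3, e4, e5⟩
          rw [e3, e4, e5]
          field_simp))
      refine (mul_le_mul_right key _).trans ?_
      refine le_trans (le_of_eq ?_) ((mul_le_mul_right (hroot_le Q) 4).trans_eq
        (mul_assoc _ _ _).symm)
      ring
    · have key := phiNorm_mul_le (fun x => (econj_inv_le (hR₂ x)).trans one_le_two)
        (fun x => (hrec x).2.1) (hPm.const_mul 2) (hCm₁.const_mul 2)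
        (Q.measurable_cut hv) (Q.measurable_cut hv₁)
        (Q.cut_ae_eq_mul (z := fun x => (w₂ x ^ (-(1 / 2) : ℝ))⁻¹) (by
          filter_upwards [hroot] with x ⟨a, b, ha, hb, e1, e2, e3, e4, e5⟩
          rw [e3, e4, e5]
          field_simp))
      refine (mul_le_mul_right key _).trans ?_
      refine le_trans (le_of_eq ?_) ((mul_le_mul_right (hroot_le Q) 4).trans_eq
        (mul_assoc _ _ _).symm)
      ring
    · have key := phiNorm_mul_le (fun x => (econj_inv_le (hR x)).trans one_le_two)
        (fun x => (hrec x).2.2.1) (hCm₁.const_mul 2) (hCm₂.const_mul 2)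
        (Q.measurable_cut hv₁) (Q.measurable_cut hv₂)
        (Q.cut_ae_eq_mul (z := fun x => (w x ^ ((1 / 2) : ℝ))⁻¹) (by
          filter_upwards [hroot] with x ⟨a, b, ha, hb, e1, e2, e3, e4, e5⟩
          rw [e3, e4, e5]
          field_simp))
      refine (mul_le_mul_right key _).trans ?_
      refine le_trans (le_of_eq ?_) ((mul_le_mul_right (hroot_le Q) 4).trans_eq
        (mul_assoc _ _ _).symm)
      ring
  · rintro ⟨⟨C₁, hC₁', h₁⟩, ⟨C₂, hC₂', h₂⟩, ⟨C, hC', h⟩⟩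
    refine ⟨(16 * (C * C₁ * C₂)) ^ 2, ENNReal.pow_ne_top (ENNReal.mul_ne_top (by simp)
      (ENNReal.mul_ne_top (ENNReal.mul_ne_top hC' hC₁') hC₂')), fun Q => ?_⟩
    rw [← mul_pow]
    refine pow_le_pow_left' ?_ 2
    specialize h₁ Q
    specialize h₂ Q
    specialize h Q
    have hu : ∀ x, ((((econj (2 * conjExp p₁ x))⁻¹ + (econj (2 * conjExp p₂ x))⁻¹)⁻¹)⁻¹ : ℝ≥0∞) =
        (econj (2 * conjExp p₁ x))⁻¹ + (econj (2 * conjExp p₂ x))⁻¹ := fun x => inv_inv _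
    have hu2 : ∀ x, ((((econj (2 * conjExp p₁ x))⁻¹ + (econj (2 * conjExp p₂ x))⁻¹)⁻¹)⁻¹ : ℝ≥0∞)
        ≤ 2 := fun x => by
      rw [hu]
      exact (add_le_add (econj_inv_le (hR₁ x)) (econj_inv_le (hR₂ x))).trans_eq one_add_one_eq_two
    have hum : Measurable fun x =>
        ((econj (2 * conjExp p₁ x))⁻¹ + (econj (2 * conjExp p₂ x))⁻¹)⁻¹ :=
      (hSm₁.inv.add hSm₂.inv).inv
    have hvi₁ : Measurable fun x => (w₁ x ^ (-(1 / 2) : ℝ))⁻¹ := hv₁.inv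
    have hvi₂ : Measurable fun x => (w₂ x ^ (-(1 / 2) : ℝ))⁻¹ := hv₂.inv
    have hvi : Measurable fun x => (w x ^ ((1 / 2) : ℝ))⁻¹ := hv.inv
    have key₁ := phiNorm_mul_le hu2 hu hSm₁ hSm₂ (Q.measurable_cut hvi₁)
      (Q.measurable_cut hvi₂) (Q.cut_ae_eq_mul (z := fun x => w x ^ ((1 / 2) : ℝ)) (by
          filter_upwards [hroot] with x ⟨a, b, ha, hb, e1, e2, e3, e4, e5⟩
          rw [e3, e4, e5, inv_inv, inv_inv]))
    have key₂ := phiNorm_mul_le (s := fun _ => 2⁻¹) (fun x => by simp)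
      (fun x => by rw [inv_inv, hu]; exact (hrec x).2.2.2) hSm hum
      (Q.measurable_cut hvi) (Q.measurable_cut hv)
      (F := Q.toSet.indicator 1) (by
        have h1 : Q.toSet.indicator 1 = Q.cut fun _ => 1 := by
          funext x
          by_cases hx : x ∈ Q.toSet <;> simp [Cube.cut, hx]
        rw [h1]
        refine Q.cut_ae_eq_mul ?_
        filter_upwards [hroot] with x ⟨a, b, ha, hb, e1, e2, e3, e4, e5⟩
        rw [e5]
        field_simp)
    have key := (phiNorm_half_indicator Q.measurableSet_toSet).trans
      (key₂.trans (mul_le_mul_right (mul_le_mul_right key₁ _) _))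
    rw [Q.volume_toSet] at key
    have hv0 : Q.vol ^ 2 ≠ 0 := pow_ne_zero _ Q.vol_ne_zero
    have hvt : Q.vol ^ 2 ≠ ∞ := ENNReal.pow_ne_top Q.vol_ne_top
    refine (ENNReal.mul_le_mul_iff_left hv0 hvt).1 ?_
    refine (mul_le_mul_right key _).trans ?_
    refine le_trans (le_of_eq ?_) ((mul_le_mul_right (mul_le_mul' (mul_le_mul' h h₁) h₂) 16).trans_eq
      (by ring))
    ring
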